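/- arXiv:2309.10968 — 2 statements merged into one kernel-verified Lean document; each statement's English description precedes it below -/
import Mathlib

section
/- In a matching market whose constraint family F ⊆ ℕ^m is hereditary and an M♮-convex set, every HM-stable matching Y is fair: there are no students s, s' and college c such that (s,c) ∈ X is acceptable for s, (s,c) ≻_s Y_s, (s',c) ∈ Y, and (s,c) ≻_c (s',c). -/
/-- The `i`-th standard unit vector in `ℕ^m`. -/
def chi {m : ℕ} (i : Fin m) : Fin m → ℕ := fun j => if j = i then 1 else 0

/-- A family `F ⊆ ℕ^m` is hereditary if it contains `0` and is downward closed
with respect to the componentwise order. -/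
def Hereditary {m : ℕ} (F : Set (Fin m → ℕ)) : Prop :=
  (0 : Fin m → ℕ) ∈ F ∧ ∀ ν ∈ F, ∀ ν' : Fin m → ℕ, ν' ≤ ν → ν' ∈ F

/-- `F ⊆ ℕ^m` is an M♮-convex set: for all `ν, ν' ∈ F` and every index `i` with
`ν i > ν' i`, either (`ν − χᵢ ∈ F` and `ν' + χᵢ ∈ F`) or there exists `j` with
`ν j < ν' j` such that `ν − χᵢ + χⱼ ∈ F` and `ν' + χᵢ − χⱼ ∈ F`. -/
def MNatConvex {m : ℕ} (F : Set (Fin m → ℕ)) : Prop :=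
  ∀ ν ∈ F, ∀ ν' ∈ F, ∀ i : Fin m, ν' i < ν i →
    ((ν - chi i ∈ F ∧ ν' + chi i ∈ F) ∨
      ∃ j : Fin m, ν j < ν' j ∧ ν - chi i + chi j ∈ F ∧ ν' + chi i - chi j ∈ F)

open scoped Classical

/-- The vector counting, for each college, the number of contracts in `Y` involving it. -/
noncomputable def nuC {S : Type*} {m : ℕ} (Y : Finset (S × Fin m)) : Fin m → ℕ :=
  fun c => (Y.filter (fun x => x.2 = c)).card

/-- `Y` is a matching: `Y ⊆ X`, each student has at most one contract in `Y`, and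
every contract in `Y` is acceptable to its student (`prefS s (some c) none` means
student `s` strictly prefers college `c` to her outside option). -/
def IsMatching {S : Type*} {m : ℕ}
    (prefS : S → Option (Fin m) → Option (Fin m) → Prop)
    (X Y : Finset (S × Fin m)) : Prop :=
  Y ⊆ X ∧ (∀ s : S, (Y.filter (fun x => x.1 = s)).card ≤ 1) ∧
    ∀ x ∈ Y, prefS x.1 (some x.2) none

/-- `(s, c) ≻_s Y_s`: contract `(s, c)` is acceptable for `s` and `s` strictly prefers
it to her assignment in `Y` (if any). -/
def PrefersOver {S : Type*} {m : ℕ}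
    (prefS : S → Option (Fin m) → Option (Fin m) → Prop)
    (Y : Finset (S × Fin m)) (s : S) (c : Fin m) : Prop :=
  prefS s (some c) none ∧ ∀ c' : Fin m, (s, c') ∈ Y → prefS s (some c) (some c')

/-- The students' choice function: each student keeps her most preferred acceptable
contract in `Z`, if any. -/
noncomputable def ChS {S : Type*} {m : ℕ}
    (prefS : S → Option (Fin m) → Option (Fin m) → Prop)
    (Z : Finset (S × Fin m)) : Finset (S × Fin m) :=
  Z.filter (fun x => prefS x.1 (some x.2) none ∧
    ∀ x' ∈ Z, x'.1 = x.1 → x' ≠ x → prefS x'.1 (some x'.2) none →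
      prefS x.1 (some x.2) (some x'.2))

/-- `Z'` is an optimal choice from `Z`: it is a feasible subset of `Z` of maximum
total weight among feasible subsets of `Z`. -/
def OptimalChoice {S : Type*} {m : ℕ} (F : Set (Fin m → ℕ)) (w : S × Fin m → ℝ)
    (Z Z' : Finset (S × Fin m)) : Prop :=
  Z' ⊆ Z ∧ nuC Z' ∈ F ∧ ∀ Z'' ⊆ Z, nuC Z'' ∈ F → ∑ x ∈ Z'', w x ≤ ∑ x ∈ Z', w x

/-- `Y` is HM-stable: `Y = Ch_S(Y)`, `Y` is feasible, and no contract `x ∈ X \ Y` is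
chosen both by the students' choice from `Y ∪ {x}` and by some optimal (colleges')
choice from `Y ∪ {x}`. -/
noncomputable def HMStable {S : Type*} {m : ℕ} (F : Set (Fin m → ℕ)) (w : S × Fin m → ℝ)
    (prefS : S → Option (Fin m) → Option (Fin m) → Prop)
    (X Y : Finset (S × Fin m)) : Prop :=
  ChS prefS Y = Y ∧ nuC Y ∈ F ∧
    ¬∃ x ∈ X, x ∉ Y ∧ x ∈ ChS prefS (insert x Y) ∧
      ∃ Z' : Finset (S × Fin m), OptimalChoice F w (insert x Y) Z' ∧ x ∈ Z'

/-- From every set of contracts containing a feasible subset there is an optimal choice. -/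
theorem exists_optimalChoice {S : Type*} {m : ℕ} {F : Set (Fin m → ℕ)} (w : S × Fin m → ℝ)
    {Y Z : Finset (S × Fin m)} (hYZ : Y ⊆ Z) (hY : nuC Y ∈ F) :
    ∃ Z', OptimalChoice F w Z Z' := by
  obtain ⟨Z', hZ', hmax⟩ := (Z.powerset.filter (fun T => nuC T ∈ F)).exists_max_image
    (fun T => ∑ x ∈ T, w x) ⟨Y, by simp [hYZ, hY]⟩
  simp only [Finset.mem_filter, Finset.mem_powerset] at hZ' hmax
  exact ⟨Z', hZ'.1, hZ'.2, fun T hT hTF => hmax T ⟨hT, hTF⟩⟩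

/-- Replacing a contract by another one with the same college does not change the counts. -/
theorem nuC_insert_erase {S : Type*} {m : ℕ} {Y : Finset (S × Fin m)} {x y : S × Fin m}
    (hx : x ∉ Y) (hy : y ∈ Y) (hxy : x.2 = y.2) : nuC (insert x (Y.erase y)) = nuC Y := by
  have hx' : x ∉ Y.erase y := fun h => hx (Finset.mem_of_mem_erase h)
  funext c
  simp only [nuC, Finset.card_filter]
  rw [Finset.sum_insert hx', hxy, Finset.add_sum_erase Y (fun z => if z.2 = c then 1 else 0) hy]

/-- A student who prefers a contract to her assignment chooses it once it is added. -/
theorem PrefersOver.mem_chS_insert {S : Type*} {m : ℕ}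
    {prefS : S → Option (Fin m) → Option (Fin m) → Prop} {Y : Finset (S × Fin m)} {s : S}
    {c : Fin m} (h : PrefersOver prefS Y s c) : (s, c) ∈ ChS prefS (insert (s, c) Y) := by
  refine Finset.mem_filter.2 ⟨Finset.mem_insert_self _ _, h.1, ?_⟩
  rintro ⟨t, d⟩ hz ht hne -
  obtain rfl : t = s := ht
  exact h.2 d (Finset.mem_of_mem_insert_of_ne hz hne)

/-- In a matching market whose constraint family is a hereditary
M♮-convex set, every HM-stable matching is fair: no student has justified envy. -/
theorem hm_stable_fair {S : Type*} [Fintype S] {m : ℕ}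
    (F : Set (Fin m → ℕ)) (hF : Hereditary F) (hM : MNatConvex F)
    (X : Finset (S × Fin m))
    (prefS : S → Option (Fin m) → Option (Fin m) → Prop)
    (hprefS : ∀ s : S, IsStrictTotalOrder (Option (Fin m)) (prefS s))
    (prefC : Fin m → S → S → Prop)
    (hprefC : ∀ c : Fin m, IsStrictTotalOrder S (prefC c))
    (w : S × Fin m → ℝ) (hwinj : Set.InjOn w ↑X) (hwpos : ∀ x ∈ X, 0 < w x)
    (hwresp : ∀ (s s' : S) (c : Fin m), (s, c) ∈ X → (s', c) ∈ X →
      prefC c s s' → w (s', c) < w (s, c))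
    (Y : Finset (S × Fin m)) (hY : IsMatching prefS X Y)
    (hstable : HMStable F w prefS X Y) :
    ¬∃ (s s' : S) (c : Fin m), (s, c) ∈ X ∧ PrefersOver prefS Y s c ∧
      (s', c) ∈ Y ∧ prefC c s s' := by
  rintro ⟨s, s', c, hx, hpref, hy, henvy⟩
  obtain ⟨-, hYF, hblock⟩ := hstable
  have hxY : (s, c) ∉ Y := fun h =>
    (hprefS s).toIsStrictOrder.toIrrefl.irrefl _ (hpref.2 c h)
  have hw : w (s', c) < w (s, c) := hwresp s s' c hx (hY.1 hy) henvy
  obtain ⟨Z, hZ⟩ := exists_optimalChoice (F := F) w (Finset.subset_insert (s, c) Y) hYF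
  refine hblock ⟨(s, c), hx, hxY, ?_, Z, hZ, ?_⟩
  · exact PrefersOver.mem_chS_insert hpref
  · by_contra hxZ
    have hZY : Z ⊆ Y := (Finset.subset_insert_iff_of_notMem hxZ).1 hZ.1
    have hle : ∑ z ∈ Z, w z ≤ ∑ z ∈ Y, w z :=
      Finset.sum_le_sum_of_subset_of_nonneg hZY fun z hz _ => (hwpos z (hY.1 hz)).le
    have hswap := hZ.2.2 (insert (s, c) (Y.erase (s', c)))
      (Finset.insert_subset_insert _ (Finset.erase_subset _ _))
      (by rwa [nuC_insert_erase hxY hy rfl])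
    rw [Finset.sum_insert fun h => hxY (Finset.mem_of_mem_erase h)] at hswap
    have hsum := Finset.add_sum_erase Y w hy
    linarith
end

section
/- Let F ⊆ (Fin m → ℕ) be hereditary and an M♮-convex set, and let X be a finite set of contracts with a map col : X → Fin m. Then for every X' ⊆ X, all inclusion-maximal feasible subsets of X' have the same cardinality; that is, if Y, Z ⊆ X' are feasible and neither can be extended by an element of X' while remaining feasible, then |Y| = |Z|. -/
/-- The vector of numbers of contracts in `Y` assigned to each college. -/
def nu {ι : Type*} [DecidableEq ι] {m : ℕ} (col : ι → Fin m) (Y : Finset ι) :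
    Fin m → ℕ := fun i => (Y.filter (fun x => col x = i)).card

/-- In an M♮-convex family, a member can be augmented
by a unit vector from any member with larger coordinate sum. -/
theorem MNatConvex.exists_add_chi_mem {m : ℕ} {F : Set (Fin m → ℕ)} (hM : MNatConvex F)
    {ν : Fin m → ℕ} (hν : ν ∈ F) (ν' : Fin m → ℕ) (hν' : ν' ∈ F)
    (hlt : ∑ k, ν k < ∑ k, ν' k) : ∃ i, ν i < ν' i ∧ ν + chi i ∈ F := by
  induction hn : ∑ k, (ν' k - ν k) using Nat.strong_induction_on generalizing ν' with
  | _ n ih =>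
    obtain ⟨i, -, hi⟩ := Finset.exists_lt_of_sum_lt hlt
    rcases hM ν' hν' ν hν i hi with ⟨-, h⟩ | ⟨j, hj, hmem, -⟩
    · exact ⟨i, hi, h⟩
    have hij : i ≠ j := by rintro rfl; omega
    have hval : ∀ k, (ν' - chi i + chi j) k
        = ν' k - (if k = i then 1 else 0) + (if k = j then 1 else 0) := fun _ => rfl
    have hsum : ∑ k, (ν' - chi i + chi j) k = ∑ k, ν' k := by
      have h : ∑ k, ((ν' - chi i + chi j) k + if k = i then 1 else 0)
          = ∑ k, (ν' k + if k = j then 1 else 0) := by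
        refine Finset.sum_congr rfl fun k _ => ?_
        rw [hval]
        by_cases hk : k = i
        · subst hk; simp only [if_true]; omega
        · simp [hk]
      simpa [Finset.sum_add_distrib] using h
    have hdec : ∑ k, ((ν' - chi i + chi j) k - ν k) < n := by
      rw [← hn]
      refine Finset.sum_lt_sum (fun k _ => ?_) ⟨i, Finset.mem_univ i, ?_⟩
      · rw [hval]
        by_cases hk : k = j
        · subst hk; simp only [if_true]; omega
        · simp only [hk, if_false]; omega
      · rw [hval]
        simp only [hij, if_true, if_false]; omega
    obtain ⟨k, hk, hkF⟩ := ih _ hdec _ hmem (hsum ▸ hlt) rfl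
    refine ⟨k, ?_, hkF⟩
    rw [hval] at hk
    by_cases hkj : k = j
    · subst hkj
      simp only [if_true, hij.symm, if_false] at hk
      omega
    · simp only [hkj, if_false] at hk
      omega

theorem sum_nu {ι : Type*} [DecidableEq ι] {m : ℕ} (col : ι → Fin m) (Y : Finset ι) :
    ∑ i, nu col Y i = Y.card :=
  (Finset.card_eq_sum_card_fiberwise fun _ _ => Finset.mem_univ _).symm

theorem nu_insert {ι : Type*} [DecidableEq ι] {m : ℕ} (col : ι → Fin m) {Y : Finset ι} {x : ι}
    (hx : x ∉ Y) : nu col (insert x Y) = nu col Y + chi (col x) := by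
  funext i
  by_cases h : col x = i
  · simp [nu, chi, Finset.filter_insert, h, hx]
  · simp [nu, chi, Finset.filter_insert, h, Ne.symm h]

/-- A maximal feasible subset of `X'` is at least as large as every feasible subset of `X'`. -/
theorem card_le_of_maximal_feasible {m : ℕ} {F : Set (Fin m → ℕ)} (hM : MNatConvex F)
    {ι : Type*} [DecidableEq ι] (col : ι → Fin m) {X' Y Z : Finset ι} (hZX : Z ⊆ X')
    (hY : nu col Y ∈ F) (hZ : nu col Z ∈ F)
    (hYmax : ∀ x ∈ X', x ∉ Y → nu col (insert x Y) ∉ F) : Z.card ≤ Y.card := by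
  by_contra! hlt
  rw [← sum_nu col Y, ← sum_nu col Z] at hlt
  obtain ⟨i, hi, hmem⟩ := hM.exists_add_chi_mem hY _ hZ hlt
  obtain ⟨x, hxZ, hxY⟩ := Finset.exists_mem_notMem_of_card_lt_card hi
  obtain ⟨hx, rfl⟩ := Finset.mem_filter.1 hxZ
  have hx' : x ∉ Y := fun h => hxY (Finset.mem_filter.2 ⟨h, rfl⟩)
  exact hYmax x (hZX hx) hx' (nu_insert col hx' ▸ hmem)

/-- If `F` is a hereditary M♮-convex set, then for every `X' ⊆ X`,
all inclusion-maximal feasible subsets of `X'` have the same cardinality. -/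
theorem maximal_feasible_same_card {m : ℕ} (F : Set (Fin m → ℕ)) (hF : Hereditary F)
    (hM : MNatConvex F) {ι : Type*} [Fintype ι] [DecidableEq ι] (col : ι → Fin m)
    (X' Y Z : Finset ι) (hYX : Y ⊆ X') (hZX : Z ⊆ X')
    (hYfeas : nu col Y ∈ F) (hZfeas : nu col Z ∈ F)
    (hYmax : ∀ x ∈ X', x ∉ Y → nu col (insert x Y) ∉ F)
    (hZmax : ∀ x ∈ X', x ∉ Z → nu col (insert x Z) ∉ F) :
    Y.card = Z.card := by
  exact le_antisymm (card_le_of_maximal_feasible hM col hYX hZfeas hYfeas hZmax)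
    (card_le_of_maximal_feasible hM col hZX hYfeas hZfeas hYmax)
end
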